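/- Let Ω ⊂ ℝ² be a compact convex body with C¹ arclength boundary parametrization c of period L, let δ ∈ (0, 1), and suppose A_δ(s) = A_δ(0) for all s, where A_δ(s) = (1/2)·∫_s^{s+δL} det(c(t) − c(s), c'(t)) dt. If moreover there is a constant θ₀ ∈ (0, π) with θ₀ ≠ π/2 such that ∠(c(s+δL) − c(s), c'(s)) = θ₀ for all s, then the boundary of Ω is a circle: there exist x₀ ∈ ℝ² and r > 0 with ‖c(s) − x₀‖ = r for all s. -/

import Mathlib

open Real InnerProductGeometry

/-- The plane `ℝ²`. -/
abbrev Plane := EuclideanSpace ℝ (Fin 2)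

/-- `c : ℝ → ℝ²` is a `C¹` arclength parametrization, of period `L`, of the
boundary of the plane body `Ω`. -/
structure IsArclengthParam (Ω : Set Plane) (c : ℝ → Plane) (L : ℝ) : Prop where
  hL : 0 < L
  contDiff : ContDiff ℝ 1 c
  unitSpeed : ∀ s, ‖deriv c s‖ = 1
  periodic : Function.Periodic c L
  injOn : Set.InjOn c (Set.Ico 0 L)
  range_eq : Set.range c = frontier Ω

/-- The determinant `det(u,v) = u₁ v₂ − u₂ v₁` of a pair of plane vectors. -/
noncomputable def det2 (u v : Plane) : ℝ := u 0 * v 1 - u 1 * v 0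

/-- The area `A_δ(s)` cut off by the boundary arc from `c s` to `c (s + δL)`
and its chord. -/
noncomputable def cutArea (c : ℝ → Plane) (L δ s : ℝ) : ℝ :=
  (1 / 2) * ∫ t in s..(s + δ * L), det2 (c t - c s) (deriv c t)

section PlaneCurve

variable {x y p q : ℝ → ℝ}

/-- If all chords of parameter length `a` cut off the same area, the cross products of the chord
with the tangent vectors at its two endpoints are opposite. -/
lemma cross_chord_add_eq_zero_of_area_const {a C : ℝ}
    (hx : ∀ s, HasDerivAt x (p s) s) (hy : ∀ s, HasDerivAt y (q s) s)
    (hp : Continuous p) (hq : Continuous q)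
    (harea : ∀ s, ∫ t in s..(s + a), ((x t - x s) * q t - (y t - y s) * p t) = C) (s : ℝ) :
    ((x (s + a) - x s) * q s - (y (s + a) - y s) * p s) +
      ((x (s + a) - x s) * q (s + a) - (y (s + a) - y s) * p (s + a)) = 0 := by
  have hxc : Continuous x := continuous_iff_continuousAt.2 fun s => (hx s).continuousAt
  have hyc : Continuous y := continuous_iff_continuousAt.2 fun s => (hy s).continuousAt
  have hgc : Continuous fun t => x t * q t - y t * p t := by fun_prop
  set G : ℝ → ℝ := fun s => ∫ t in (0 : ℝ)..s, (x t * q t - y t * p t) with hG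
  have hGd : ∀ s, HasDerivAt G (x s * q s - y s * p s) s := fun s =>
    intervalIntegral.integral_hasDerivAt_right (hgc.intervalIntegrable _ _)
      (hgc.stronglyMeasurableAtFilter _ _) hgc.continuousAt
  have key : ∀ s, G (s + a) - G s - x s * (y (s + a) - y s) + y s * (x (s + a) - x s) = C := by
    intro s
    have h1 : G (s + a) - G s = ∫ t in s..(s + a), (x t * q t - y t * p t) :=
      intervalIntegral.integral_interval_sub_left (hgc.intervalIntegrable _ _)
        (hgc.intervalIntegrable _ _)
    have h2 : ∫ t in s..(s + a), q t = y (s + a) - y s :=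
      intervalIntegral.integral_eq_sub_of_hasDerivAt (fun t _ => hy t) (hq.intervalIntegrable _ _)
    have h3 : ∫ t in s..(s + a), p t = x (s + a) - x s :=
      intervalIntegral.integral_eq_sub_of_hasDerivAt (fun t _ => hx t) (hp.intervalIntegrable _ _)
    rw [h1, ← h2, ← h3, ← harea s, ← intervalIntegral.integral_const_mul,
      ← intervalIntegral.integral_const_mul, ← intervalIntegral.integral_sub,
      ← intervalIntegral.integral_add]
    · congr 1
      ext t
      ring
    all_goals exact Continuous.intervalIntegrable (by fun_prop) _ _
  have hX : HasDerivAt (fun s => x (s + a) - x s) (p (s + a) - p s) s :=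
    ((hx (s + a)).comp_add_const s a).sub (hx s)
  have hY : HasDerivAt (fun s => y (s + a) - y s) (q (s + a) - q s) s :=
    ((hy (s + a)).comp_add_const s a).sub (hy s)
  have hd := ((((hGd (s + a)).comp_add_const s a).sub (hGd s)).sub ((hx s).mul hY)).add
    ((hy s).mul hX)
  have hc := hd.unique ((hasDerivAt_const s C).congr_of_eventuallyEq (.of_forall key))
  linear_combination hc

/-- A periodic differentiable function has a critical point. -/
lemma Function.Periodic.exists_hasDerivAt_eq_zero {f f' : ℝ → ℝ} {L : ℝ}
    (hf : Function.Periodic f L) (hL : 0 < L) (hd : ∀ s, HasDerivAt f (f' s) s) :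
    ∃ s, f' s = 0 := by
  obtain ⟨s, -, hs⟩ := _root_.exists_hasDerivAt_eq_zero hL
    (fun s _ => (hd s).continuousAt.continuousWithinAt) (by simpa using (hf 0).symm)
    fun s _ => hd s
  exact ⟨s, hs⟩

lemma eq_or_eq_neg_of_continuous_of_sq_eq {f g : ℝ → ℝ} (hf : Continuous f) (hg : Continuous g)
    (hsq : ∀ s, f s ^ 2 = g s ^ 2) (hg0 : ∀ s, g s ≠ 0) :
    (∀ s, f s = g s) ∨ ∀ s, f s = -g s := by
  rcases isPreconnected_univ.eq_or_eq_neg_of_sq_eq hf.continuousOn hg.continuousOn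
    (fun s _ => hsq s) (fun {s} _ => hg0 s) with h | h
  · exact .inl fun s => h (Set.mem_univ s)
  · exact .inr fun s => h (Set.mem_univ s)

/-- A closed unit speed curve whose chords of parameter length `a` make a constant oblique angle
with the tangent at the initial endpoint, and have opposite cross products with the tangents
at the two endpoints, lies on a circle. -/
lemma exists_center_of_cross_chord_of_angle_const {a L k : ℝ} (hL : 0 < L)
    (hx : ∀ s, HasDerivAt x (p s) s) (hy : ∀ s, HasDerivAt y (q s) s)
    (hp : Continuous p) (hq : Continuous q) (hpq : ∀ s, p s ^ 2 + q s ^ 2 = 1)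
    (hxL : Function.Periodic x L) (hyL : Function.Periodic y L)
    (hcross : ∀ s, ((x (s + a) - x s) * q s - (y (s + a) - y s) * p s) +
      ((x (s + a) - x s) * q (s + a) - (y (s + a) - y s) * p (s + a)) = 0)
    (hk0 : k ≠ 0) (hk1 : k ^ 2 < 1)
    (hne : ∀ s, 0 < (x (s + a) - x s) ^ 2 + (y (s + a) - y s) ^ 2)
    (hangle : ∀ s, (x (s + a) - x s) * p s + (y (s + a) - y s) * q s =
      k * √((x (s + a) - x s) ^ 2 + (y (s + a) - y s) ^ 2)) :
    ∃ x₀ y₀ r : ℝ, 0 < r ∧ ∀ s, (x s - x₀) ^ 2 + (y s - y₀) ^ 2 = r ^ 2 := by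
  have hxc : Continuous x := continuous_iff_continuousAt.2 fun s => (hx s).continuousAt
  have hyc : Continuous y := continuous_iff_continuousAt.2 fun s => (hy s).continuousAt
  set X : ℝ → ℝ := fun s => x (s + a) - x s with hXdef
  set Y : ℝ → ℝ := fun s => y (s + a) - y s with hYdef
  have hX : ∀ s, HasDerivAt X (p (s + a) - p s) s := fun s =>
    ((hx (s + a)).comp_add_const s a).sub (hx s)
  have hY : ∀ s, HasDerivAt Y (q (s + a) - q s) s := fun s =>
    ((hy (s + a)).comp_add_const s a).sub (hy s)
  have hXc : Continuous X := by fun_prop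
  have hYc : Continuous Y := by fun_prop
  change ∀ s, (X s * q s - Y s * p s) + (X s * q (s + a) - Y s * p (s + a)) = 0 at hcross
  change ∀ s, 0 < X s ^ 2 + Y s ^ 2 at hne
  change ∀ s, X s * p s + Y s * q s = k * √(X s ^ 2 + Y s ^ 2) at hangle
  have hN : ∀ s, HasDerivAt (fun s => X s ^ 2 + Y s ^ 2)
      (2 * ((X s * p (s + a) + Y s * q (s + a)) - (X s * p s + Y s * q s))) s := fun s => by
    refine (((hX s).pow 2).add ((hY s).pow 2)).congr_deriv ?_
    push_cast
    ring
  have hdot0 : ∀ s, X s * p s + Y s * q s ≠ 0 := fun s => by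
    rw [hangle]
    exact mul_ne_zero hk0 (Real.sqrt_pos.2 (hne s)).ne'
  have hdotsq : ∀ s, (X s * p (s + a) + Y s * q (s + a)) ^ 2 = (X s * p s + Y s * q s) ^ 2 := by
    intro s
    linear_combination (X s ^ 2 + Y s ^ 2) * (hpq (s + a) - hpq s) +
      ((X s * q s - Y s * p s) - (X s * q (s + a) - Y s * p (s + a))) * hcross s
  rcases eq_or_eq_neg_of_continuous_of_sq_eq (f := fun s => X s * p (s + a) + Y s * q (s + a))
    (by fun_prop) (by fun_prop) hdotsq hdot0 with hdot | hdot
  swap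
  · have hper : Function.Periodic (fun s => X s ^ 2 + Y s ^ 2) L := fun s => by
      simp only [hXdef, hYdef, add_right_comm s L a, hxL _, hyL _]
    obtain ⟨s, hs⟩ := hper.exists_hasDerivAt_eq_zero hL hN
    refine absurd ?_ (hdot0 s)
    linarith [hdot s]
  have hNconst : ∀ s, X s ^ 2 + Y s ^ 2 = X 0 ^ 2 + Y 0 ^ 2 := fun s =>
    is_const_of_deriv_eq_zero (fun s => (hN s).differentiableAt)
      (fun s => by rw [(hN s).deriv, hdot s]; ring) s 0
  set N := X 0 ^ 2 + Y 0 ^ 2 with hNdef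
  have hNpos : 0 < N := hne 0
  simp only [hNconst] at hangle
  set P := k * √N with hP
  have hPsq : P ^ 2 = k ^ 2 * N := by rw [hP, mul_pow, Real.sq_sqrt hNpos.le]
  have hE : 0 < N - P ^ 2 := by rw [hPsq]; nlinarith
  have hDsq : ∀ s, (p s * Y s - q s * X s) ^ 2 = √(N - P ^ 2) ^ 2 := fun s => by
    rw [Real.sq_sqrt hE.le, ← hangle s, ← hNconst s]
    linear_combination (X s ^ 2 + Y s ^ 2) * hpq s
  obtain ⟨D, hD0, hD⟩ : ∃ D : ℝ, D ≠ 0 ∧ ∀ s, p s * Y s - q s * X s = D := by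
    rcases eq_or_eq_neg_of_continuous_of_sq_eq (f := fun s => p s * Y s - q s * X s)
      (by fun_prop) continuous_const hDsq fun _ => (Real.sqrt_pos.2 hE).ne' with h | h
    · exact ⟨_, (Real.sqrt_pos.2 hE).ne', h⟩
    · exact ⟨_, neg_ne_zero.2 (Real.sqrt_pos.2 hE).ne', h⟩
  have hdot' : ∀ s, X s * p (s + a) + Y s * q (s + a) = P := fun s => (hdot s).trans (hangle s)
  have hD' : ∀ s, X s * q (s + a) - Y s * p (s + a) = D := fun s => by
    linear_combination hcross s + hD s
  have hp1 : ∀ s, N * p s = P * X s + D * Y s := fun s => by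
    rw [← hangle s, ← hD s, ← hNconst s]; ring
  have hq1 : ∀ s, N * q s = P * Y s - D * X s := fun s => by
    rw [← hangle s, ← hD s, ← hNconst s]; ring
  have hp2 : ∀ s, N * p (s + a) = P * X s - D * Y s := fun s => by
    rw [← hdot' s, ← hD' s, ← hNconst s]; ring
  have hq2 : ∀ s, N * q (s + a) = P * Y s + D * X s := fun s => by
    rw [← hdot' s, ← hD' s, ← hNconst s]; ring
  -- The centre lies on the perpendicular bisector of every chord, at signed distance
  -- proportional to `P / (2 * D)`.
  have hx₀ : ∀ s, HasDerivAt (fun s => x s + X s / 2 - P / (2 * D) * Y s) 0 s := fun s => by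
    refine (((hx s).add ((hX s).div_const 2)).sub ((hY s).const_mul (P / (2 * D)))).congr_deriv ?_
    refine (mul_eq_zero.1 (?_ : N * _ = 0)).resolve_left hNpos.ne'
    field_simp
    linear_combination D * (hp1 s + hp2 s) - P * (hq2 s - hq1 s)
  have hy₀ : ∀ s, HasDerivAt (fun s => y s + Y s / 2 + P / (2 * D) * X s) 0 s := fun s => by
    refine (((hy s).add ((hY s).div_const 2)).add ((hX s).const_mul (P / (2 * D)))).congr_deriv ?_
    refine (mul_eq_zero.1 (?_ : N * _ = 0)).resolve_left hNpos.ne'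
    field_simp
    linear_combination D * (hq1 s + hq2 s) + P * (hp2 s - hp1 s)
  have hx₀c := is_const_of_deriv_eq_zero (fun s => (hx₀ s).differentiableAt) fun s => (hx₀ s).deriv
  have hy₀c := is_const_of_deriv_eq_zero (fun s => (hy₀ s).differentiableAt) fun s => (hy₀ s).deriv
  have hr : 0 < N * (1 / 4 + (P / (2 * D)) ^ 2) := by positivity
  refine ⟨x 0 + X 0 / 2 - P / (2 * D) * Y 0, y 0 + Y 0 / 2 + P / (2 * D) * X 0,
    √(N * (1 / 4 + (P / (2 * D)) ^ 2)), Real.sqrt_pos.2 hr, fun s => ?_⟩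
  rw [Real.sq_sqrt hr.le, ← hx₀c s 0, ← hy₀c s 0, ← hNconst s]
  ring

end PlaneCurve

/-- Kovalev: if a compact convex plane body floats in the
archimedean sense in equilibrium in every orientation at density `δ`, and the
moving chord makes a constant angle `θ₀ ≠ π/2` with the boundary, then the
boundary is a circle. -/
theorem constant_angle_imp_circle
    (Ω : Set Plane) (c : ℝ → Plane) (L : ℝ)
    (hcomp : IsCompact Ω) (hconv : Convex ℝ Ω) (hint : (interior Ω).Nonempty)
    (hparam : IsArclengthParam Ω c L) (δ : ℝ) (hδ0 : 0 < δ) (hδ1 : δ < 1)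
    (harea : ∀ s : ℝ, cutArea c L δ s = cutArea c L δ 0)
    (θ₀ : ℝ) (hθ0 : 0 < θ₀) (hθπ : θ₀ < π) (hθ : θ₀ ≠ π / 2)
    (hangle : ∀ s : ℝ, angle (c (s + δ * L) - c s) (deriv c s) = θ₀) :
    ∃ (x₀ : Plane) (r : ℝ), 0 < r ∧ ∀ s : ℝ, ‖c s - x₀‖ = r := by
  have hdiff : ∀ s, HasDerivAt c (deriv c s) s := fun s =>
    (hparam.contDiff.differentiable one_ne_zero s).hasDerivAt
  have hcont : Continuous (deriv c) := hparam.contDiff.continuous_deriv le_rfl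
  have hcoord : ∀ i s, HasDerivAt (fun s => c s i) (deriv c s i) s := fun i s =>
    (EuclideanSpace.proj (𝕜 := ℝ) i).hasFDerivAt.comp_hasDerivAt s (hdiff s)
  have hcoordc : ∀ i, Continuous fun s => deriv c s i := fun i =>
    (EuclideanSpace.proj (𝕜 := ℝ) i).continuous.comp hcont
  have hcross := cross_chord_add_eq_zero_of_area_const (a := δ * L) (C := 2 * cutArea c L δ 0)
    (hcoord 0) (hcoord 1) (hcoordc 0) (hcoordc 1) fun s => by
      rw [← harea s, cutArea]
      simp [det2]
  have hnorm : ∀ s, ‖c (s + δ * L) - c s‖ =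
      √((c (s + δ * L) 0 - c s 0) ^ 2 + (c (s + δ * L) 1 - c s 1) ^ 2) := fun s => by
    simp [EuclideanSpace.norm_eq, Fin.sum_univ_two]
  have hcos : cos θ₀ ≠ 0 := fun h =>
    hθ (injOn_cos ⟨hθ0.le, hθπ.le⟩ ⟨by positivity, by linarith [pi_pos]⟩ (by rw [h, cos_pi_div_two]))
  have hsin : 0 < sin θ₀ := sin_pos_of_pos_of_lt_pi hθ0 hθπ
  obtain ⟨x₀, y₀, r, hr, h⟩ := exists_center_of_cross_chord_of_angle_const (a := δ * L)
    (k := cos θ₀) hparam.hL (hcoord 0) (hcoord 1) (hcoordc 0) (hcoordc 1)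
    (fun s => by
      have := hparam.unitSpeed s
      rw [EuclideanSpace.norm_eq, Real.sqrt_eq_one] at this
      simpa [Fin.sum_univ_two] using this)
    (fun s => by simp only [hparam.periodic s]) (fun s => by simp only [hparam.periodic s])
    hcross hcos (by nlinarith [sin_sq_add_cos_sq θ₀])
    (fun s => by
      rw [← Real.sqrt_pos, ← hnorm, norm_pos_iff]
      intro h0
      refine hθ ?_
      rw [← hangle s, h0, angle_zero_left])
    (fun s => by
      rw [← hnorm, ← hangle s]
      have := cos_angle_mul_norm_mul_norm (c (s + δ * L) - c s) (deriv c s)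
      rw [hparam.unitSpeed, mul_one] at this
      rw [this]
      simp [PiLp.inner_apply, Fin.sum_univ_two, mul_comm])
  refine ⟨!₂[x₀, y₀], r, hr, fun s => ?_⟩
  rw [EuclideanSpace.norm_eq, Real.sqrt_eq_iff_eq_sq (by positivity) hr.le, ← h s]
  simp [Fin.sum_univ_two]
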